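/- In ℤ⟦X⟧, the formal derivative U′ of the spherical generating function U of the cubic matrix model satisfies (1 − 12X·U)·U′ = 4U^2, and the formal derivative of X·V satisfies (1 − 12X·U)·(X·V)′ = 2, where V is the other spherical generating function. -/

import Mathlib

open PowerSeries Finset

/-- The linear equation of `mk u` over `mk v`. -/
theorem mk_eq_one_add_two_mul (u v : ℕ → ℤ) (hu0 : u 0 = 1)
    (hu : ∀ k : ℕ, u (k + 1) = 2 * ∑ p ∈ Finset.range (k + 1), u (k - p) * v p) :
    PowerSeries.mk u = 1 + 2 * (X * (PowerSeries.mk v * PowerSeries.mk u)) := by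
  rw [two_mul]
  ext (_ | k)
  · simp [hu0]
  · rw [map_add, map_add, coeff_succ_X_mul, coeff_mul,
      Nat.sum_antidiagonal_eq_sum_range_succ_mk]
    simp [hu, two_mul, coeff_one, mul_comm (v _)]

/-- The quadratic equation of `mk v` over `mk u`. -/
theorem mk_eq_two_mul_add_sq (u v : ℕ → ℤ)
    (hv : ∀ k : ℕ, v k = 2 * u k + ∑ p ∈ Finset.range k, v (k - 1 - p) * v p) :
    PowerSeries.mk v = 2 * PowerSeries.mk u + X * (PowerSeries.mk v * PowerSeries.mk v) := by
  rw [two_mul]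
  ext (_ | k)
  · simpa [two_mul] using hv 0
  · rw [map_add, map_add, coeff_succ_X_mul, coeff_mul,
      Nat.sum_antidiagonal_eq_sum_range_succ_mk]
    simp only [coeff_mk, hv (k + 1), Nat.add_sub_cancel, two_mul, mul_comm (v (k - _))]

/-- A derivation with `D x = 1` on a solution of `a = 1 + 2wa`, `w = 2xa + w²`. -/
theorem derivation_of_cubic_equations {S R : Type*} [CommRing S] [CommRing R] [Algebra S R]
    (D : Derivation S R R) {x a w : R} (hx : D x = 1) (ha : a = 1 + 2 * (w * a)) (hw : w = 2 * (x * a) + w * w) :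
    (1 - 12 * x * a) * D a = 4 * a ^ 2 ∧ (1 - 12 * x * a) * D w = 2 := by
  have h2 : D 2 = 0 := by simpa using D.map_natCast 2
  have hDa := congrArg D ha
  have hDw := congrArg D hw
  simp only [map_add, Derivation.leibniz, Derivation.map_one_eq_zero, h2, hx, smul_eq_mul]
    at hDa hDw
  have hinv : a * (1 - 2 * w) = 1 := by linear_combination ha
  have hDa' : D a = 2 * a ^ 2 * D w := by linear_combination a * hDa - D a * hinv
  have hDw' : D w = 2 * a ^ 2 + 4 * x * a ^ 3 * D w := by
    linear_combination a * hDw - D w * hinv + 2 * x * a * hDa'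
  have hsq : (1 - 2 * w) ^ 2 = 1 - 8 * x * a := by linear_combination -4 * hw
  have hmain : (1 - 12 * x * a) * D w = 2 := by
    linear_combination (1 - 2 * w) ^ 2 * hDw' - D w * hsq +
      (4 * x * a * D w + 2) * (a * (1 - 2 * w) + 1) * hinv
  exact ⟨by linear_combination (1 - 12 * x * a) * hDa' + 2 * a ^ 2 * hmain, hmain⟩

/-- The formal derivatives of the spherical generating functions of the cubic matrix
model satisfy `(1 - 12X·U)·U' = 4U²` and `(1 - 12X·U)·(X·V)' = 2` in `ℤ⟦X⟧`. -/
theorem cubic_spherical_derivatives (u v : ℕ → ℤ)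
    (hu0 : u 0 = 1)
    (hu : ∀ k : ℕ, u (k + 1) = 2 * ∑ p ∈ Finset.range (k + 1), u (k - p) * v p)
    (hv : ∀ k : ℕ, v k = 2 * u k + ∑ p ∈ Finset.range k, v (k - 1 - p) * v p) :
    (1 - 12 * PowerSeries.X * PowerSeries.mk u) *
        PowerSeries.derivative ℤ (PowerSeries.mk u) =
      4 * (PowerSeries.mk u) ^ 2 ∧
    (1 - 12 * PowerSeries.X * PowerSeries.mk u) *
        PowerSeries.derivative ℤ (PowerSeries.X * PowerSeries.mk v) = 2 := by
  have hU := mk_eq_one_add_two_mul u v hu0 hu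
  have hV := mk_eq_two_mul_add_sq u v hv
  exact derivation_of_cubic_equations (PowerSeries.derivative ℤ) (derivative_X (R := ℤ))
    (by linear_combination hU) (by linear_combination X * hV)
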